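/- Let c1 = (c11, c12) and c2 = (c21, c22) be vectors in ℤ² with Γ := |c11·c22 − c12·c21| ≠ 0, and set g1 = gcd(c11, c12), g2 = gcd(c21, c22), g3 = gcd(c11+c21, c12+c22). Then each of the three pairwise sums is at most Γ + 1: g1 + g2 ≤ Γ + 1, g1 + g3 ≤ Γ + 1, and g2 + g3 ≤ Γ + 1. -/

import Mathlib

/-- The product of the contents of two integer vectors divides their determinant. -/
theorem gcd_mul_gcd_dvd_natAbs_det (a b c d : ℤ) :
    Int.gcd a b * Int.gcd c d ∣ (a * d - b * c).natAbs := by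
  rw [← Int.natCast_dvd, Nat.cast_mul]
  exact dvd_sub (mul_dvd_mul (Int.gcd_dvd_left a b) (Int.gcd_dvd_right c d))
    (mul_dvd_mul (Int.gcd_dvd_right a b) (Int.gcd_dvd_left c d))

/-- The contents of two linearly independent integer vectors sum to at most the absolute value of
their determinant plus one. -/
theorem gcd_add_gcd_le_natAbs_det_add_one (a b c d : ℤ) (h : (a * d - b * c).natAbs ≠ 0) :
    Int.gcd a b + Int.gcd c d ≤ (a * d - b * c).natAbs + 1 := by
  have hdvd := gcd_mul_gcd_dvd_natAbs_det a b c d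
  have hle := Nat.le_of_dvd (Nat.pos_of_ne_zero h) hdvd
  have hne : Int.gcd a b * Int.gcd c d ≠ 0 := ne_zero_of_dvd_ne_zero h hdvd
  have h₁ : 1 ≤ Int.gcd a b := Nat.pos_of_ne_zero (left_ne_zero_of_mul hne)
  have h₂ : 1 ≤ Int.gcd c d := Nat.pos_of_ne_zero (right_ne_zero_of_mul hne)
  nlinarith


/-- Let `c1 = (c11, c12)` and `c2 = (c21, c22)` be vectors in `ℤ²` with
`Γ := |c11·c22 − c12·c21| ≠ 0`, and set `g1 = gcd(c11, c12)`, `g2 = gcd(c21, c22)`,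
`g3 = gcd(c11+c21, c12+c22)`.  Then each of the three pairwise sums is at most `Γ + 1`:
`g1 + g2 ≤ Γ + 1`, `g1 + g3 ≤ Γ + 1` and `g2 + g3 ≤ Γ + 1`. -/
theorem pairwise_gcd_sums_le (c11 c12 c21 c22 : ℤ)
    (hΓ : (c11 * c22 - c12 * c21).natAbs ≠ 0) :
    Int.gcd c11 c12 + Int.gcd c21 c22 ≤ (c11 * c22 - c12 * c21).natAbs + 1 ∧
    Int.gcd c11 c12 + Int.gcd (c11 + c21) (c12 + c22) ≤ (c11 * c22 - c12 * c21).natAbs + 1 ∧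
    Int.gcd c21 c22 + Int.gcd (c11 + c21) (c12 + c22) ≤ (c11 * c22 - c12 * c21).natAbs + 1 := by
  have h₁₃ : c11 * (c12 + c22) - c12 * (c11 + c21) = c11 * c22 - c12 * c21 := by ring
  have h₃₂ : (c11 + c21) * c22 - (c12 + c22) * c21 = c11 * c22 - c12 * c21 := by ring
  refine ⟨gcd_add_gcd_le_natAbs_det_add_one _ _ _ _ hΓ, ?_, ?_⟩
  · rw [← h₁₃] at hΓ ⊢
    exact gcd_add_gcd_le_natAbs_det_add_one _ _ _ _ hΓ
  · rw [add_comm, ← h₃₂]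
    rw [← h₃₂] at hΓ
    exact gcd_add_gcd_le_natAbs_det_add_one _ _ _ _ hΓ
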